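/- arXiv:1708.04397 — 2 statements merged into one kernel-verified Lean document; each statement's English description precedes it below -/
import Mathlib

section
/- If the word problem of H with respect to the generators a_1, a_2, … is solvable — i.e., there exists a computable function d : List (ℕ × Bool) → Bool such that for every list L, d(L) = true if and only if the product in H of the letters a_i^{±1} encoded by L equals 1 — then the membership problem for φ(H) in G is solvable: there exists a computable function m : List (Fin 2 × Bool) → Bool such that for every list L, m(L) = true if and only if the corresponding product of the letters c^{±1}, s^{±1} lies in the image of φ. -/
open SemidirectProduct

section WreathDef

variable (A B : Type*) [Group A] [Group B]

/-- The action of `B` on the base group `B → A` by `(b • f) x = f (x * b)`. -/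
def wrAut : B →* MulAut (B → A) where
  toFun b :=
    { toFun := fun f x => f (x * b)
      invFun := fun f x => f (x * b⁻¹)
      left_inv := fun f => funext fun x => by simp
      right_inv := fun f => funext fun x => by simp
      map_mul' := fun f g => rfl }
  map_one' := by
    ext f x
    simp
  map_mul' := fun b₁ b₂ => by
    ext f x
    simp [mul_assoc]

/-- The (unrestricted) wreath product `A Wr B`, as the semidirect product `(B → A) ⋊ B`. -/
abbrev Wr := (B → A) ⋊[wrAut A B] B

end WreathDef

/-- The infinite cyclic group `ℤ`, written multiplicatively. -/
abbrev Zm := Multiplicative ℤ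

section Elements

variable {H : Type*} [Group H]

/-- The element `z` of `H Wr ℤ`: trivial passive part, active part `1 ∈ ℤ`. -/
def zElt : Wr H Zm := inr (Multiplicative.ofAdd 1)

/-- The element `b i` of `H Wr ℤ`: passive part `k ↦ a i` for `k > 0` and `1` otherwise. -/
def bElt (a : ℕ → H) (i : ℕ) : Wr H Zm :=
  inl fun k => if 0 < Multiplicative.toAdd k then a i else 1

/-- The element `s` of `(H Wr ℤ) Wr ℤ`: trivial passive part, active part `1 ∈ ℤ`. -/
def sElt : Wr (Wr H Zm) Zm := inr (Multiplicative.ofAdd 1)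

open Classical in
/-- The element `c` of `(H Wr ℤ) Wr ℤ`: base element with passive part sending
`1 ↦ z`, `2^i ↦ b i` for `i ≥ 1`, and everything else to `1`. -/
noncomputable def cElt (a : ℕ → H) : Wr (Wr H Zm) Zm :=
  inl fun k =>
    if Multiplicative.toAdd k = 1 then zElt
    else if h : ∃ i : ℕ, 1 ≤ i ∧ Multiplicative.toAdd k = 2 ^ i then bElt a h.choose
    else 1

/-- The subgroup `G = ⟨c, s⟩` of `(H Wr ℤ) Wr ℤ`. -/
noncomputable def Gsub (a : ℕ → H) : Subgroup (Wr (Wr H Zm) Zm) :=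
  Subgroup.closure {cElt a, sElt}

/-- The map `φ : H → (H Wr ℤ) Wr ℤ`, sending `h` to the base element supported at `1 ∈ ℤ`
whose value is the base element of `H Wr ℤ` supported at `0 ∈ ℤ` with value `h`. -/
def phiElt (h : H) : Wr (Wr H Zm) Zm :=
  inl fun k =>
    if Multiplicative.toAdd k = 1 then
      (inl fun m => if Multiplicative.toAdd m = 0 then h else 1 : Wr H Zm)
    else 1

end Elements

/-- The product in `H` of the letters `a i ^ ±1` encoded by a list: the pair `(i, b)`
encodes the generator `a (i+1)` (inverted when `b = true`). -/
def evalH {H : Type*} [Group H] (a : ℕ → H) (L : List (ℕ × Bool)) : H :=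
  (L.map fun p => if p.2 then (a (p.1 + 1))⁻¹ else a (p.1 + 1)).prod

/-- The product in `(H Wr ℤ) Wr ℤ` of the letters `c^±1, s^±1` encoded by a list:
`(0, b)` encodes `c` and `(1, b)` encodes `s` (inverted when `b = true`). -/
noncomputable def evalG {H : Type*} [Group H] (a : ℕ → H) (L : List (Fin 2 × Bool)) :
    Wr (Wr H Zm) Zm :=
  (L.map fun p =>
    if p.2 then (if p.1 = 0 then cElt a else sElt)⁻¹
    else if p.1 = 0 then cElt a else sElt).prod

section Computability

/-- The greatest `i ≤ r` with `2 ^ i = r`, or `0` if there is none. -/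
def powIndex (r : ℕ) : ℕ := Nat.findGreatest (fun i => 2 ^ i = r) r

lemma powIndex_two_pow (i : ℕ) : powIndex (2 ^ i) = i := by
  have h : 2 ^ powIndex (2 ^ i) = 2 ^ i :=
    Nat.findGreatest_spec (P := fun j => 2 ^ j = 2 ^ i) (Nat.lt_two_pow_self (n := i)).le rfl
  exact Nat.pow_right_injective le_rfl h

lemma primrec_two_pow : Primrec fun i : ℕ => 2 ^ i :=
  (Primrec.nat_rec₁ 1 (Primrec.nat_mul.comp (Primrec.const 2) Primrec.snd).to₂).of_eq fun i => by
    induction i with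
    | zero => rfl
    | succ i ih => simp only [ih]; rw [pow_succ']

lemma primrec_powIndex : Primrec powIndex :=
  Primrec.nat_findGreatest Primrec.id
    (Primrec.eq.comp (primrec_two_pow.comp Primrec.snd) Primrec.fst)

/-- An integer, represented by a pair of natural numbers as a difference, together with a second
such integer and a word in the letters of `H`. -/
abbrev TraceState := (ℕ × ℕ) × (ℕ × ℕ) × List (ℕ × Bool)

/-- Add `-1` (if `b`) or `1` (otherwise) to the integer represented by `p`. -/
def moveBy (b : Bool) (p : ℕ × ℕ) : ℕ × ℕ :=
  if b = true then (p.1, p.2 + 1) else (p.1 + 1, p.2)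

/-- Read one letter of a word in `c, s`, tracking the outer coordinate, the inner coordinate, and
the word in the letters of `H` read off at these coordinates. -/
def traceStep (t : TraceState) (p : Fin 2 × Bool) : TraceState :=
  if p.1 = 0 then
    if t.1.1 = t.1.2 + 1 then (t.1, moveBy p.2 t.2.1, t.2.2)
    else if (0 < powIndex (t.1.1 - t.1.2) ∧ 2 ^ powIndex (t.1.1 - t.1.2) = t.1.1 - t.1.2) ∧
        t.2.1.2 < t.2.1.1 then
      (t.1, t.2.1, t.2.2 ++ [(powIndex (t.1.1 - t.1.2) - 1, p.2)])
    else t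
  else (moveBy p.2 t.1, t.2)

/-- Read a whole word in `c, s`. -/
def trace (L : List (Fin 2 × Bool)) (t : TraceState) : TraceState := L.foldl traceStep t

lemma primrec_moveBy : Primrec₂ moveBy :=
  Primrec.ite (Primrec.eq.comp Primrec.fst (Primrec.const true))
    (Primrec.pair (Primrec.fst.comp Primrec.snd)
      (Primrec.succ.comp (Primrec.snd.comp Primrec.snd)))
    (Primrec.pair (Primrec.succ.comp (Primrec.fst.comp Primrec.snd))
      (Primrec.snd.comp Primrec.snd))

lemma primrec_traceStep : Primrec₂ traceStep := by
  have hu : Primrec fun q : TraceState × (Fin 2 × Bool) => q.1.1.1 :=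
    Primrec.fst.comp (Primrec.fst.comp Primrec.fst)
  have hv : Primrec fun q : TraceState × (Fin 2 × Bool) => q.1.1.2 :=
    Primrec.snd.comp (Primrec.fst.comp Primrec.fst)
  have hm : Primrec fun q : TraceState × (Fin 2 × Bool) => q.1.2.1 :=
    Primrec.fst.comp (Primrec.snd.comp Primrec.fst)
  have hw : Primrec fun q : TraceState × (Fin 2 × Bool) => q.1.2.2 :=
    Primrec.snd.comp (Primrec.snd.comp Primrec.fst)
  have hb : Primrec fun q : TraceState × (Fin 2 × Bool) => q.2.2 :=
    Primrec.snd.comp Primrec.snd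
  have hr : Primrec fun q : TraceState × (Fin 2 × Bool) => q.1.1.1 - q.1.1.2 :=
    Primrec.nat_sub.comp hu hv
  have hi : Primrec fun q : TraceState × (Fin 2 × Bool) => powIndex (q.1.1.1 - q.1.1.2) :=
    primrec_powIndex.comp hr
  refine Primrec.ite (Primrec.eq.comp (Primrec.fst.comp Primrec.snd) (Primrec.const 0)) ?_
    (Primrec.pair (primrec_moveBy.comp hb (Primrec.fst.comp Primrec.fst))
      (Primrec.snd.comp Primrec.fst))
  refine Primrec.ite (Primrec.eq.comp hu (Primrec.succ.comp hv))
    (Primrec.pair (Primrec.fst.comp Primrec.fst)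
      (Primrec.pair (primrec_moveBy.comp hb hm) hw)) ?_
  refine Primrec.ite (((Primrec.nat_lt.comp (Primrec.const 0) hi).and
    (Primrec.eq.comp (primrec_two_pow.comp hi) hr)).and
      (Primrec.nat_lt.comp (Primrec.snd.comp hm) (Primrec.fst.comp hm))) ?_ Primrec.fst
  exact Primrec.pair (Primrec.fst.comp Primrec.fst) (Primrec.pair hm
    (Primrec.list_concat.comp hw (Primrec.pair
      (Primrec.nat_sub.comp hi (Primrec.const 1)) hb)))

lemma primrec_trace : Primrec₂ trace :=
  Primrec.list_foldl Primrec.fst Primrec.snd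
    (primrec_traceStep.comp (Primrec.fst.comp Primrec.snd) (Primrec.snd.comp Primrec.snd)).to₂

/-- Bounded universal quantification of a Boolean-valued function. -/
def forallLT (n : ℕ) (f : ℕ → Bool) : Bool :=
  Nat.rec true (fun i b => b && f i) n

lemma forallLT_eq_true {n : ℕ} {f : ℕ → Bool} : forallLT n f = true ↔ ∀ i < n, f i = true := by
  induction n with
  | zero => simp [forallLT]
  | succ n ih =>
    have h : forallLT (n + 1) f = (forallLT n f && f n) := rfl
    rw [h, Bool.and_eq_true, ih, Nat.forall_lt_succ_right]

lemma computable_forallLT {α : Type*} [Primcodable α] {n : α → ℕ} {f : α → ℕ → Bool}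
    (hn : Computable n) (hf : Computable₂ f) : Computable fun x => forallLT (n x) (f x) :=
  Computable.nat_rec hn (Computable.const true)
    (Primrec.and.to_comp.comp (Computable.snd.comp Computable.snd)
      (hf.comp Computable.fst (Computable.fst.comp Computable.snd))).to₂

/-- The test that a trace started at `((x, M), (y, M), [])` returns to its coordinates and reads a
trivial word, where triviality is not required at the coordinates `x = M + 1`, `y = M`, and `d` is
used as word problem oracle. -/
def stateTest (d : List (ℕ × Bool) → Bool) (t : TraceState) (M x y : ℕ) : Bool :=
  (decide (t.1.1 + M = t.1.2 + x) && decide (t.2.1.1 + M = t.2.1.2 + y)) &&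
    (d t.2.2 || (decide (x = M + 1) && decide (y = M)))

/-- The test that the word `L` looks like an element of the image of `phiElt` at the outer
coordinate `x - M` and inner coordinate `y - M`, using `d` as word problem oracle. -/
def coordTest (d : List (ℕ × Bool) → Bool) (L : List (Fin 2 × Bool)) (M x y : ℕ) : Bool :=
  stateTest d (trace L ((x, M), (y, M), [])) M x y

/-- A bound for the absolute values of the coordinates that have to be tested. -/
def testRadius (L : List (Fin 2 × Bool)) : ℕ := 3 * L.length + 3

/-- The decision procedure for membership in the image of `phiElt`. -/
def memTest (d : List (ℕ × Bool) → Bool) (L : List (Fin 2 × Bool)) : Bool :=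
  forallLT (2 * testRadius L + 1) fun x => forallLT (2 * testRadius L + 1) fun y =>
    coordTest d L (testRadius L) x y

lemma primrec_testRadius : Primrec testRadius :=
  Primrec.nat_add.comp (Primrec.nat_mul.comp (Primrec.const 3) Primrec.list_length)
    (Primrec.const 3)

lemma computable_stateTest {d : List (ℕ × Bool) → Bool} (hd : Computable d) :
    Computable fun q : TraceState × ℕ × ℕ × ℕ => stateTest d q.1 q.2.1 q.2.2.1 q.2.2.2 := by
  have ht : Primrec fun q : TraceState × ℕ × ℕ × ℕ => q.1 := Primrec.fst
  have hM : Primrec fun q : TraceState × ℕ × ℕ × ℕ => q.2.1 := Primrec.fst.comp Primrec.snd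
  have hx : Primrec fun q : TraceState × ℕ × ℕ × ℕ => q.2.2.1 :=
    Primrec.fst.comp (Primrec.snd.comp Primrec.snd)
  have hy : Primrec fun q : TraceState × ℕ × ℕ × ℕ => q.2.2.2 :=
    Primrec.snd.comp (Primrec.snd.comp Primrec.snd)
  have hp : Primrec fun q : TraceState × ℕ × ℕ × ℕ => q.1.1 := Primrec.fst.comp ht
  have hq : Primrec fun q : TraceState × ℕ × ℕ × ℕ => q.1.2.1 :=
    Primrec.fst.comp (Primrec.snd.comp ht)
  have hw : Primrec fun q : TraceState × ℕ × ℕ × ℕ => q.1.2.2 :=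
    Primrec.snd.comp (Primrec.snd.comp ht)
  have h₁ : Primrec fun q : TraceState × ℕ × ℕ × ℕ =>
      decide (q.1.1.1 + q.2.1 = q.1.1.2 + q.2.2.1) :=
    (Primrec.eq.comp (Primrec.nat_add.comp (Primrec.fst.comp hp) hM)
      (Primrec.nat_add.comp (Primrec.snd.comp hp) hx)).decide
  have h₂ : Primrec fun q : TraceState × ℕ × ℕ × ℕ =>
      decide (q.1.2.1.1 + q.2.1 = q.1.2.1.2 + q.2.2.2) :=
    (Primrec.eq.comp (Primrec.nat_add.comp (Primrec.fst.comp hq) hM)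
      (Primrec.nat_add.comp (Primrec.snd.comp hq) hy)).decide
  have h₃ : Primrec fun q : TraceState × ℕ × ℕ × ℕ => decide (q.2.2.1 = q.2.1 + 1) :=
    (Primrec.eq.comp hx (Primrec.succ.comp hM)).decide
  have h₄ : Primrec fun q : TraceState × ℕ × ℕ × ℕ => decide (q.2.2.2 = q.2.1) :=
    (Primrec.eq.comp hy hM).decide
  exact Primrec.and.to_comp.comp (Primrec.and.comp h₁ h₂).to_comp
    (Primrec.or.to_comp.comp (hd.comp hw.to_comp) (Primrec.and.comp h₃ h₄).to_comp)

lemma computable_coordTest {d : List (ℕ × Bool) → Bool} (hd : Computable d) :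
    Computable fun q : (List (Fin 2 × Bool) × ℕ) × ℕ × ℕ =>
      coordTest d q.1.1 q.1.2 q.2.1 q.2.2 := by
  have hM : Primrec fun q : (List (Fin 2 × Bool) × ℕ) × ℕ × ℕ => q.1.2 :=
    Primrec.snd.comp Primrec.fst
  have hx : Primrec fun q : (List (Fin 2 × Bool) × ℕ) × ℕ × ℕ => q.2.1 :=
    Primrec.fst.comp Primrec.snd
  have hy : Primrec fun q : (List (Fin 2 × Bool) × ℕ) × ℕ × ℕ => q.2.2 :=
    Primrec.snd.comp Primrec.snd
  have ht : Primrec fun q : (List (Fin 2 × Bool) × ℕ) × ℕ × ℕ =>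
      trace q.1.1 ((q.2.1, q.1.2), (q.2.2, q.1.2), []) :=
    primrec_trace.comp (Primrec.fst.comp Primrec.fst) (Primrec.pair (Primrec.pair hx hM)
      (Primrec.pair (Primrec.pair hy hM) (Primrec.const [])))
  have hq : Computable fun q : (List (Fin 2 × Bool) × ℕ) × ℕ × ℕ =>
      (trace q.1.1 ((q.2.1, q.1.2), (q.2.2, q.1.2), []), q.1.2, q.2.1, q.2.2) :=
    (Primrec.pair ht (Primrec.pair hM (Primrec.pair hx hy))).to_comp
  exact ((computable_stateTest hd).comp hq).of_eq fun _ => rfl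

lemma computable_memTest {d : List (ℕ × Bool) → Bool} (hd : Computable d) :
    Computable (memTest d) := by
  have hR : Computable testRadius := primrec_testRadius.to_comp
  have hS : Computable fun L : List (Fin 2 × Bool) => 2 * testRadius L + 1 :=
    (Primrec.succ.comp (Primrec.nat_mul.comp (Primrec.const 2) primrec_testRadius)).to_comp
  have hcell : Computable₂ fun (q : List (Fin 2 × Bool) × ℕ) (y : ℕ) =>
      coordTest d q.1 (testRadius q.1) q.2 y := by
    have hq : Computable fun q : (List (Fin 2 × Bool) × ℕ) × ℕ =>
        ((q.1.1, testRadius q.1.1), q.1.2, q.2) :=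
      Computable.pair (Computable.pair (Computable.fst.comp Computable.fst)
        (hR.comp (Computable.fst.comp Computable.fst)))
        (Computable.pair (Computable.snd.comp Computable.fst) Computable.snd)
    exact ((computable_coordTest hd).comp hq).of_eq fun _ => rfl
  have hS' : Computable fun q : List (Fin 2 × Bool) × ℕ => 2 * testRadius q.1 + 1 :=
    hS.comp Computable.fst
  have hrow : Computable₂ fun (L : List (Fin 2 × Bool)) (x : ℕ) =>
      forallLT (2 * testRadius L + 1) fun y => coordTest d L (testRadius L) x y :=
    (computable_forallLT hS' hcell).of_eq fun _ => rfl
  exact (computable_forallLT hS hrow).of_eq fun _ => rfl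

end Computability

section Coordinates

open Multiplicative

variable {H : Type*} [Group H] (a : ℕ → H)

/-- The value of the passive part of `cElt a` at `k`. -/
noncomputable def cVal (k : ℤ) : Wr H Zm := (cElt a).left (ofAdd k)

lemma cVal_one : cVal a 1 = zElt := by simp [cVal, cElt]

lemma cVal_two_pow {i : ℕ} (hi : 1 ≤ i) : cVal a (2 ^ i) = bElt a i := by
  have h1 : (2 : ℤ) ^ i ≠ 1 := (one_lt_pow₀ (by norm_num) (by omega)).ne'
  have h : ∃ j : ℕ, 1 ≤ j ∧ (2 : ℤ) ^ i = 2 ^ j := ⟨i, hi, rfl⟩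
  have hc : h.choose = i :=
    (Int.pow_right_injective (a := 2) (by norm_num) h.choose_spec.2).symm
  simp only [cVal, cElt, left_inl, toAdd_ofAdd]
  rw [if_neg h1, dif_pos h, hc]

lemma cVal_eq_one {k : ℤ} (hk : ∀ i : ℕ, k ≠ 2 ^ i) : cVal a k = 1 := by
  have h : ¬ ∃ j : ℕ, 1 ≤ j ∧ k = 2 ^ j := fun ⟨j, _, hj⟩ => hk j hj
  simp only [cVal, cElt, left_inl, toAdd_ofAdd]
  rw [if_neg (by simpa using hk 0), dif_neg h]

/-- The value of the passive part of `evalG a L` at `k`. -/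
noncomputable def gVal (L : List (Fin 2 × Bool)) (k : ℤ) : Wr H Zm := (evalG a L).left (ofAdd k)

/-- The integer `1` or `-1`, according to whether a letter is inverted. -/
def letterSign (b : Bool) : ℤ := if b = true then -1 else 1

/-- The total exponent of the letter `s` in a word. -/
def shiftSum (L : List (Fin 2 × Bool)) : ℤ :=
  (L.map fun p => if p.1 = 0 then 0 else letterSign p.2).sum

lemma evalG_cons (p : Fin 2 × Bool) (L : List (Fin 2 × Bool)) :
    evalG a (p :: L) = (if p.2 then (if p.1 = 0 then cElt a else sElt)⁻¹
      else if p.1 = 0 then cElt a else sElt) * evalG a L := by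
  simp [evalG]

lemma evalG_right (L : List (Fin 2 × Bool)) : (evalG a L).right = ofAdd (shiftSum L) := by
  induction L with
  | nil => rfl
  | cons p L ih =>
    obtain ⟨g, b⟩ := p
    rw [evalG_cons, mul_right, ih]
    by_cases hg : g = 0 <;> cases b <;>
      simp [hg, shiftSum, letterSign, cElt, sElt, ofAdd_add]

lemma inr_mul_left_apply {A : Type*} [Group A] (t k : Zm) (g : Wr A Zm) :
    ((inr t : Wr A Zm) * g).left k = g.left (k * t) :=
  one_mul (g.left (k * t))

lemma gVal_nil (k : ℤ) : gVal a [] k = 1 := rfl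

lemma gVal_c (b : Bool) (L : List (Fin 2 × Bool)) (k : ℤ) :
    gVal a ((0, b) :: L) k = cVal a k ^ letterSign b * gVal a L k := by
  have hr : (cElt a).right = 1 := rfl
  cases b <;> simp [gVal, cVal, evalG_cons, letterSign, inv_left, hr]

lemma gVal_s (b : Bool) (L : List (Fin 2 × Bool)) (k : ℤ) :
    gVal a ((1, b) :: L) k = gVal a L (k + letterSign b) := by
  have hs : (if b = true then sElt⁻¹ else sElt : Wr (Wr H Zm) Zm) = inr (ofAdd (letterSign b)) := by
    cases b
    · rfl
    · exact (map_inv (inr : Zm →* Wr (Wr H Zm) Zm) (ofAdd 1)).symm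
  rw [gVal, evalG_cons, if_neg one_ne_zero, hs, inr_mul_left_apply, ← ofAdd_add, gVal]

lemma letter_cases {P : Fin 2 × Bool → Prop} (hc : ∀ b, P (0, b)) (hs : ∀ b, P (1, b))
    (p : Fin 2 × Bool) : P p := by
  obtain ⟨g, b⟩ := p
  fin_cases g
  exacts [hc b, hs b]

lemma letterSign_cases (b : Bool) : letterSign b = 1 ∨ letterSign b = -1 := by
  cases b <;> simp [letterSign]

/-- The active part of `gVal a L k`, as an integer. -/
noncomputable def gShift (L : List (Fin 2 × Bool)) (k : ℤ) : ℤ := toAdd (gVal a L k).right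

/-- The passive part of `gVal a L k` at `m`. -/
noncomputable def gCoord (L : List (Fin 2 × Bool)) (k m : ℤ) : H := (gVal a L k).left (ofAdd m)

lemma zElt_zpow (n : ℤ) : (zElt : Wr H Zm) ^ n = inr (ofAdd n) := by
  rw [zElt, ← map_zpow, ← ofAdd_zsmul]; simp

lemma bElt_zpow (i : ℕ) (n : ℤ) : bElt a i ^ n =
    inl fun k : Zm => if 0 < toAdd k then a i ^ n else 1 := by
  rw [bElt, ← map_zpow]
  congr 1
  funext k
  by_cases h : 0 < toAdd k <;> simp [h]

lemma gShift_nil (k : ℤ) : gShift a [] k = 0 := rfl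

lemma gCoord_nil (k m : ℤ) : gCoord a [] k m = 1 := rfl

lemma gShift_s (b : Bool) (L : List (Fin 2 × Bool)) (k : ℤ) :
    gShift a ((1, b) :: L) k = gShift a L (k + letterSign b) := by
  rw [gShift, gVal_s, gShift]

lemma gCoord_s (b : Bool) (L : List (Fin 2 × Bool)) (k m : ℤ) :
    gCoord a ((1, b) :: L) k m = gCoord a L (k + letterSign b) m := by
  rw [gCoord, gVal_s, gCoord]

lemma gShift_c_one (b : Bool) (L : List (Fin 2 × Bool)) :
    gShift a ((0, b) :: L) 1 = letterSign b + gShift a L 1 := by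
  rw [gShift, gVal_c, cVal_one, zElt_zpow]
  simp [gShift]

lemma gCoord_c_one (b : Bool) (L : List (Fin 2 × Bool)) (m : ℤ) :
    gCoord a ((0, b) :: L) 1 m = gCoord a L 1 (m + letterSign b) := by
  rw [gCoord, gVal_c, cVal_one, zElt_zpow]
  rw [inr_mul_left_apply, ← ofAdd_add, gCoord]

lemma gCoord_c_two_pow (b : Bool) (L : List (Fin 2 × Bool)) (m : ℤ) {i : ℕ} (hi : 1 ≤ i) :
    gCoord a ((0, b) :: L) (2 ^ i) m =
      (if 0 < m then a i ^ letterSign b else 1) * gCoord a L (2 ^ i) m := by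
  rw [gCoord, gVal_c, cVal_two_pow a hi, bElt_zpow]
  simp [gCoord]

lemma gCoord_c_of_ne (b : Bool) (L : List (Fin 2 × Bool)) (m : ℤ) {k : ℤ}
    (hk : ∀ i : ℕ, k ≠ 2 ^ i) : gCoord a ((0, b) :: L) k m = gCoord a L k m := by
  rw [gCoord, gVal_c, cVal_eq_one a hk]
  simp [gCoord]

lemma gShift_c_of_ne (b : Bool) (L : List (Fin 2 × Bool)) {k : ℤ}
    (hk : k ≠ 1) : gShift a ((0, b) :: L) k = gShift a L k := by
  rw [gShift, gVal_c]
  by_cases h : ∃ i : ℕ, k = 2 ^ i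
  · obtain ⟨i, rfl⟩ := h
    rw [cVal_two_pow a (Nat.one_le_iff_ne_zero.2 fun h => hk (by simp [h])), bElt_zpow]
    simp [gShift]
  · rw [cVal_eq_one a (not_exists.1 h)]
    simp [gShift]

lemma moveBy_sub (b : Bool) (p : ℕ × ℕ) :
    ((moveBy b p).1 : ℤ) - (moveBy b p).2 = p.1 - p.2 + letterSign b := by
  cases b <;> simp [moveBy, letterSign] <;> ring

lemma evalH_concat (W : List (ℕ × Bool)) (i : ℕ) (b : Bool) :
    evalH a (W ++ [(i, b)]) = evalH a W * a (i + 1) ^ letterSign b := by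
  cases b <;> simp [evalH, letterSign]

lemma trace_spec (L : List (Fin 2 × Bool)) (t : TraceState) :
    ((trace L t).1.1 : ℤ) - (trace L t).1.2 = t.1.1 - t.1.2 + shiftSum L ∧
    ((trace L t).2.1.1 : ℤ) - (trace L t).2.1.2 =
      t.2.1.1 - t.2.1.2 + gShift a L (t.1.1 - t.1.2) ∧
    evalH a (trace L t).2.2 =
      evalH a t.2.2 * gCoord a L (t.1.1 - t.1.2) (t.2.1.1 - t.2.1.2) := by
  induction L generalizing t with
  | nil => simp [trace, shiftSum, gShift_nil, gCoord_nil]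
  | cons p L ih =>
    have ht : trace (p :: L) t = trace L (traceStep t p) := rfl
    rw [ht]
    obtain ⟨h₁, h₂, h₃⟩ := ih (traceStep t p)
    rw [h₁, h₂, h₃]
    clear h₁ h₂ h₃ ht ih
    induction p using letter_cases with
    | hs b =>
      simp only [traceStep, one_ne_zero, if_false, moveBy_sub, gShift_s, gCoord_s, shiftSum,
        List.map_cons, List.sum_cons, and_self, and_true]
      ring
    | hc b =>
      have hsum : shiftSum ((0, b) :: L) = shiftSum L := by simp [shiftSum]
      rw [hsum]
      obtain ⟨⟨u, v⟩, ⟨y, y'⟩, W⟩ := t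
      by_cases h1 : u = v + 1
      · have hk : (u : ℤ) - v = 1 := by omega
        simp only [traceStep, if_true, if_pos h1, moveBy_sub, hk, gShift_c_one, gCoord_c_one,
          true_and, and_true]
        ring
      have hk1 : (u : ℤ) - v ≠ 1 := by omega
      by_cases h2 : 0 < powIndex (u - v) ∧ 2 ^ powIndex (u - v) = u - v
      · obtain ⟨hpos, hpow⟩ := h2
        have hk : (u : ℤ) - v = 2 ^ powIndex (u - v) := by
          have := Nat.pos_of_ne_zero (n := u - v) (by rw [← hpow]; positivity)
          have h3 : ((2 ^ powIndex (u - v) : ℕ) : ℤ) = ((u - v : ℕ) : ℤ) := by rw [hpow]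
          push_cast at h3
          omega
        by_cases h3 : y' < y
        · have h4 : (0 : ℤ) < y - y' := by omega
          simp only [traceStep, if_true, if_neg h1, hpos, hpow, h3, and_self,
            gShift_c_of_ne a b L hk1, evalH_concat, true_and]
          rw [hk, gCoord_c_two_pow a b L _ hpos, if_pos h4, mul_assoc, Nat.sub_add_cancel hpos]
        · have h4 : ¬ (0 : ℤ) < y - y' := by omega
          simp only [traceStep, if_true, if_neg h1, h3, and_false, if_false,
            gShift_c_of_ne a b L hk1, true_and]
          rw [hk, gCoord_c_two_pow a b L _ hpos, if_neg h4, one_mul]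
      · have hk : ∀ i : ℕ, (u : ℤ) - v ≠ 2 ^ i := by
          intro i hi
          have h3 : u - v = 2 ^ i := by
            have : (0 : ℤ) < 2 ^ i := by positivity
            zify [show v ≤ u by omega]
            exact hi
          apply h2
          rw [h3, powIndex_two_pow]
          refine ⟨Nat.pos_of_ne_zero ?_, rfl⟩
          rintro rfl
          exact hk1 (by simpa using hi)
        simp only [traceStep, if_true, if_neg h1, h2, false_and, if_false,
            gShift_c_of_ne a b L hk1, gCoord_c_of_ne a b L _ hk, true_and]

lemma cVal_eq_one_of_nonpos {k : ℤ} (hk : k ≤ 0) : cVal a k = 1 :=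
  cVal_eq_one a fun i h => by
    have : (0 : ℤ) < 2 ^ i := by positivity
    omega

lemma gVal_of_add_length_nonpos {L : List (Fin 2 × Bool)} {k : ℤ} (hk : k + L.length ≤ 0) :
    gVal a L k = 1 := by
  induction L generalizing k with
  | nil => rfl
  | cons p L ih =>
    rw [List.length_cons] at hk
    push_cast at hk
    induction p using letter_cases with
    | hc b => rw [gVal_c, cVal_eq_one_of_nonpos a (by omega), one_zpow, one_mul, ih (by omega)]
    | hs b =>
      rw [gVal_s, ih]
      rcases letterSign_cases b with h | h <;> omega

lemma gShift_of_length_lt {L : List (Fin 2 × Bool)} {k : ℤ} (hk : (L.length : ℤ) + 1 < k) :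
    gShift a L k = 0 := by
  induction L generalizing k with
  | nil => rfl
  | cons p L ih =>
    rw [List.length_cons] at hk
    push_cast at hk
    induction p using letter_cases with
    | hc b => rw [gShift_c_of_ne a b L (by omega), ih (by omega)]
    | hs b =>
      rw [gShift_s, ih]
      rcases letterSign_cases b with h | h <;> omega

lemma gCoord_of_add_length_nonpos {L : List (Fin 2 × Bool)} {k m : ℤ}
    (hm : m + L.length ≤ 0) : gCoord a L k m = 1 := by
  induction L generalizing k m with
  | nil => rfl
  | cons p L ih =>
    rw [List.length_cons] at hm
    push_cast at hm
    induction p using letter_cases with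
    | hs b => rw [gCoord_s, ih (by omega)]
    | hc b =>
      by_cases h : ∃ i : ℕ, k = 2 ^ i
      · obtain ⟨i, rfl⟩ := h
        rcases Nat.eq_zero_or_pos i with rfl | hi
        · rw [pow_zero, gCoord_c_one, ih]
          rcases letterSign_cases b with h | h <;> omega
        · rw [gCoord_c_two_pow a b L m hi, if_neg (by omega), one_mul, ih (by omega)]
      · rw [gCoord_c_of_ne a b L m (not_exists.1 h), ih (by omega)]

lemma gCoord_eq_of_length_lt {L : List (Fin 2 × Bool)} {k m n : ℤ}
    (hm : (L.length : ℤ) < m) (hn : (L.length : ℤ) < n) : gCoord a L k m = gCoord a L k n := by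
  induction L generalizing k m n with
  | nil => rfl
  | cons p L ih =>
    rw [List.length_cons] at hm hn
    push_cast at hm hn
    induction p using letter_cases with
    | hs b => rw [gCoord_s, gCoord_s, ih (n := n) (by omega) (by omega)]
    | hc b =>
      by_cases h : ∃ i : ℕ, k = 2 ^ i
      · obtain ⟨i, rfl⟩ := h
        rcases Nat.eq_zero_or_pos i with rfl | hi
        · rw [pow_zero, gCoord_c_one, gCoord_c_one]
          apply ih <;> rcases letterSign_cases b with h | h <;> omega
        · rw [gCoord_c_two_pow a b L m hi, gCoord_c_two_pow a b L n hi, if_pos (by omega),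
            if_pos (by omega), ih (n := n) (by omega) (by omega)]
      · rw [gCoord_c_of_ne a b L m (not_exists.1 h), gCoord_c_of_ne a b L n (not_exists.1 h),
          ih (n := n) (by omega) (by omega)]

/-- If the window of radius `L.length` around `k` meets the support of `c` in at most one point `n`,
then `gVal a L k` is a power of the value of `c` at `n`. -/
lemma gVal_eq_zpow {L : List (Fin 2 × Bool)} {k n : ℤ}
    (h : ∀ r : ℤ, |r - k| ≤ L.length → r ≠ n → cVal a r = 1) :
    gVal a L k = cVal a n ^ gShift a L (k - n + 1) := by
  induction L generalizing k with
  | nil => simp [gVal_nil, gShift_nil]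
  | cons p L ih =>
    rw [List.length_cons] at h
    push_cast at h
    induction p using letter_cases with
    | hs b =>
      rw [gVal_s, gShift_s, ih, show k + letterSign b - n + 1 = k - n + 1 + letterSign b by ring]
      intro r hr hrn
      refine h r ?_ hrn
      rw [abs_le] at hr ⊢
      rcases letterSign_cases b with h | h <;> constructor <;> omega
    | hc b =>
      rw [gVal_c, ih fun r hr hrn => h r (by omega) hrn]
      by_cases hkn : k = n
      · subst hkn
        rw [sub_self, zero_add, gShift_c_one, zpow_add]
      · rw [gShift_c_of_ne a b L (by omega), h k (by simp; omega) hkn, one_zpow, one_mul]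

lemma gVal_of_three_mul_length_lt {L : List (Fin 2 × Bool)} {k : ℤ}
    (hk : 3 * (L.length : ℤ) < k) (hs : ∀ j, gShift a L j = 0) : gVal a L k = 1 := by
  suffices h : ∃ n : ℤ, ∀ r : ℤ, |r - k| ≤ L.length → r ≠ n → cVal a r = 1 by
    obtain ⟨n, hn⟩ := h
    rw [gVal_eq_zpow a hn, hs, zpow_zero]
  by_cases h : ∃ i : ℕ, |(2 : ℤ) ^ i - k| ≤ L.length
  · obtain ⟨i, hi⟩ := h
    refine ⟨2 ^ i, fun r hr hrn => cVal_eq_one a ?_⟩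
    rintro j rfl
    have key : ∀ i j : ℕ, |(2 : ℤ) ^ i - k| ≤ L.length → |(2 : ℤ) ^ j - k| ≤ L.length →
        ¬ i < j := by
      intro i j hi hj hij
      have h1 : (2 : ℤ) ^ (i + 1) ≤ 2 ^ j := pow_le_pow_right₀ (by norm_num) hij
      rw [pow_succ] at h1
      rw [abs_le] at hi hj
      omega
    rcases lt_trichotomy i j with hij | rfl | hij
    · exact key i j hi hr hij
    · exact hrn rfl
    · exact key j i hr hi hij
  · exact ⟨0, fun r hr _ => cVal_eq_one a fun i hri => h ⟨i, hri ▸ hr⟩⟩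

lemma evalG_mem_range_phiElt_iff (L : List (Fin 2 × Bool)) :
    evalG a L ∈ Set.range (phiElt (H := H)) ↔ shiftSum L = 0 ∧
      ∀ k m : ℤ, gShift a L k = 0 ∧ (gCoord a L k m = 1 ∨ (k = 1 ∧ m = 0)) := by
  constructor
  · rintro ⟨h, hh⟩
    refine ⟨?_, fun k m => ?_⟩
    · have := evalG_right a L
      rw [← hh] at this
      exact (ofAdd_eq_one.1 this.symm)
    · rw [gShift, gCoord, gVal, ← hh, phiElt]
      by_cases hk : k = 1 <;> by_cases hm : m = 0 <;> simp [hk, hm]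
  · rintro ⟨h₁, h₂⟩
    refine ⟨gCoord a L 1 0, ?_⟩
    refine SemidirectProduct.ext ?_ ?_
    · funext k
      refine SemidirectProduct.ext ?_ ?_
      · funext m
        change _ = gCoord a L (toAdd k) (toAdd m)
        obtain h | ⟨hk, hm⟩ := (h₂ (toAdd k) (toAdd m)).2
        · by_cases hk : toAdd k = 1 <;> by_cases hm : toAdd m = 0 <;>
            simp_all [phiElt]
        · rw [hk, hm]
          simp only [phiElt, left_inl, hk, hm, if_true]
      · have h : toAdd ((evalG a L).left k).right = 0 := (h₂ (toAdd k) 0).1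
        rw [toAdd_eq_zero.1 h, phiElt]
        by_cases hk : toAdd k = 1 <;> simp [hk]
    · rw [evalG_right, h₁]
      rfl

lemma coordTest_eq_true {d : List (ℕ × Bool) → Bool}
    (hd : ∀ W : List (ℕ × Bool), d W = true ↔ evalH a W = 1)
    (L : List (Fin 2 × Bool)) (M x y : ℕ) :
    coordTest d L M x y = true ↔ shiftSum L = 0 ∧ gShift a L (x - M) = 0 ∧
      (gCoord a L (x - M) (y - M) = 1 ∨ ((x : ℤ) - M = 1 ∧ (y : ℤ) - M = 0)) := by
  obtain ⟨h₁, h₂, h₃⟩ := trace_spec a L ((x, M), (y, M), [])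
  have hnil : evalH a [] = 1 := rfl
  dsimp only at h₁ h₂ h₃
  rw [hnil, one_mul] at h₃
  rw [coordTest, stateTest, Bool.and_eq_true, Bool.and_eq_true, Bool.or_eq_true,
    Bool.and_eq_true, decide_eq_true_eq, decide_eq_true_eq, decide_eq_true_eq,
    decide_eq_true_eq, hd, h₃, and_assoc]
  refine and_congr (by omega) (and_congr (by omega) (or_congr Iff.rfl (by omega)))

lemma memTest_eq_true {d : List (ℕ × Bool) → Bool}
    (hd : ∀ W : List (ℕ × Bool), d W = true ↔ evalH a W = 1) (L : List (Fin 2 × Bool)) :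
    memTest d L = true ↔ evalG a L ∈ Set.range (phiElt (H := H)) := by
  simp only [memTest, forallLT_eq_true, coordTest_eq_true a hd, evalG_mem_range_phiElt_iff]
  refine ⟨fun h => ?_, fun ⟨h₁, h₂⟩ x _ y _ => ⟨h₁, h₂ _ _⟩⟩
  have hM : testRadius L = 3 * L.length + 3 := rfl
  have hbox : ∀ k m : ℤ, |k| ≤ testRadius L → |m| ≤ testRadius L →
      gShift a L k = 0 ∧ (gCoord a L k m = 1 ∨ (k = 1 ∧ m = 0)) := by
    intro k m hk hm
    rw [abs_le] at hk hm
    obtain ⟨x, hx⟩ := Int.eq_ofNat_of_zero_le (a := k + testRadius L) (by omega)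
    obtain ⟨y, hy⟩ := Int.eq_ofNat_of_zero_le (a := m + testRadius L) (by omega)
    have := (h x (by omega) y (by omega)).2
    rwa [show (x : ℤ) - testRadius L = k by omega,
      show (y : ℤ) - testRadius L = m by omega] at this
  have hshift : ∀ k, gShift a L k = 0 := by
    intro k
    by_cases h₁ : k + L.length ≤ 0
    · rw [gShift, gVal_of_add_length_nonpos a h₁]; rfl
    by_cases h₂ : (L.length : ℤ) + 1 < k
    · exact gShift_of_length_lt a h₂
    · exact (hbox k 0 (by rw [abs_le]; omega) (by simp)).1
  refine ⟨(h 0 (by omega) 0 (by omega)).1, fun k m => ⟨hshift k, ?_⟩⟩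
  by_cases h₁ : k + L.length ≤ 0
  · left; rw [gCoord, gVal_of_add_length_nonpos a h₁]; rfl
  by_cases h₂ : 3 * (L.length : ℤ) < k
  · left; rw [gCoord, gVal_of_three_mul_length_lt a h₂ hshift]; rfl
  have hk : |k| ≤ testRadius L := by rw [abs_le]; omega
  by_cases h₃ : m + L.length ≤ 0
  · exact Or.inl (gCoord_of_add_length_nonpos a h₃)
  by_cases h₄ : (L.length : ℤ) < m
  · left
    rw [gCoord_eq_of_length_lt a h₄ (n := L.length + 1) (by omega)]
    obtain h | ⟨_, h⟩ := (hbox k (L.length + 1) hk (by rw [abs_le]; omega)).2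
    · exact h
    · omega
  · exact (hbox k m hk (by rw [abs_le]; omega)).2

end Coordinates

/-- if the word problem of `H` w.r.t. the generators `a_1, a_2, …` is solvable,
then the membership problem for `φ(H)` in `G` is solvable. -/
theorem stmt3 {H : Type*} [Group H] (a : ℕ → H)
    (hgen : Subgroup.closure {x : H | ∃ i : ℕ, 1 ≤ i ∧ a i = x} = ⊤)
    (hWP : ∃ d : List (ℕ × Bool) → Bool, Computable d ∧
      ∀ L : List (ℕ × Bool), d L = true ↔ evalH a L = 1) :
    ∃ m : List (Fin 2 × Bool) → Bool, Computable m ∧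
      ∀ L : List (Fin 2 × Bool), m L = true ↔ evalG a L ∈ Set.range (phiElt (H := H)) := by
  obtain ⟨d, hdc, hd⟩ := hWP
  exact ⟨memTest d, computable_memTest hdc, memTest_eq_true a hd⟩
end

section
/- The element w = (c^{s^{γ₁}})^{β₁}···(c^{s^{γₙ}})^{βₙ}·s^γ equals the identity in (H Wr ℤ) Wr ℤ if and only if: γ = 0, for every i ∈ {1,…,n} the sum ∑_{j : γⱼ = γᵢ} βⱼ equals 0, and f(μ) = 1 for every integer μ with |μ| ≤ 3γ₀, where γ₀ = max_j |γⱼ| and f = (c^{s^{γ₁}})^{β₁}···(c^{s^{γₙ}})^{βₙ}. -/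
open SemidirectProduct

/-- The base-subgroup element `f = (c^(s^(γ 1)))^(β 1) ⋯ (c^(s^(γ n)))^(β n)`,
where `x ^ y = y * x * y⁻¹`. -/
noncomputable def fProd {H : Type*} [Group H] (a : ℕ → H) {n : ℕ} (β γ : Fin n → ℤ) :
    Wr (Wr H Zm) Zm :=
  ((List.finRange n).map fun j => (sElt ^ γ j * cElt a * (sElt ^ γ j)⁻¹) ^ β j).prod

/-- `γ₀ = max_j |γ j|`. -/
def gamma0 {n : ℕ} (γ : Fin n → ℤ) : ℕ :=
  Finset.univ.sup fun j => (γ j).natAbs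

section Lemmas

variable {H : Type*} [Group H]

/-- The passive part of `c` takes nontrivial values only at powers of two. -/
theorem cElt_left_eq_one (a : ℕ → H) {k : ℤ} (hk : ∀ i : ℕ, k ≠ 2 ^ i) :
    (cElt a).left (Multiplicative.ofAdd k) = 1 := by
  have h1 : k ≠ 1 := by simpa using hk 0
  have h2 : ¬ ∃ i : ℕ, 1 ≤ i ∧ k = 2 ^ i := fun ⟨i, _, hi⟩ => hk i hi
  simp [cElt, h1, h2]

theorem cElt_left_right (a : ℕ → H) (k : ℤ) :
    ((cElt a).left (Multiplicative.ofAdd k)).right =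
      Multiplicative.ofAdd (if k = 1 then 1 else 0) := by
  simp only [cElt, left_inl, toAdd_ofAdd]
  split_ifs <;> simp [zElt, bElt]

theorem sElt_zpow (m : ℤ) :
    (sElt : Wr (Wr H Zm) Zm) ^ m = inr (Multiplicative.ofAdd m) := by
  rw [sElt, ← map_zpow, ← ofAdd_zsmul]
  simp

theorem conj_cElt (a : ℕ → H) (m : ℤ) :
    sElt ^ m * cElt a * (sElt ^ m)⁻¹ =
      inl (wrAut (Wr H Zm) Zm (Multiplicative.ofAdd m) (cElt a).left) := by
  rw [inl_aut, sElt_zpow, ← map_inv]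
  rfl

theorem fProd_eq_inl (a : ℕ → H) {n : ℕ} (β γ : Fin n → ℤ) :
    fProd a β γ = inl (((List.finRange n).map fun j =>
      wrAut (Wr H Zm) Zm (Multiplicative.ofAdd (γ j)) (cElt a).left ^ β j).prod) := by
  rw [map_list_prod, List.map_map, fProd]
  congr 2
  funext j
  rw [conj_cElt, ← map_zpow]
  rfl

theorem fProd_left_apply (a : ℕ → H) {n : ℕ} (β γ : Fin n → ℤ) (μ : ℤ) :
    (fProd a β γ).left (Multiplicative.ofAdd μ) =
      ((List.finRange n).map fun j =>
        (cElt a).left (Multiplicative.ofAdd (μ + γ j)) ^ β j).prod := by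
  rw [fProd_eq_inl, left_inl]
  refine (map_list_prod (Pi.evalMonoidHom (fun _ : Zm => Wr H Zm) (Multiplicative.ofAdd μ))
    _).trans ?_
  rw [List.map_map]
  rfl

theorem list_prod_map_zpow {G ι : Type*} [Group G] (x : G) (e : ι → ℤ) (l : List ι) :
    (l.map fun j => x ^ e j).prod = x ^ (l.map e).sum := by
  induction l with
  | nil => simp
  | cons j l ih => simp [ih, zpow_add]

/-- The active part of `f μ` is the sum of the exponents `β j` with `μ + γ j = 1`. -/
theorem fProd_left_right (a : ℕ → H) {n : ℕ} (β γ : Fin n → ℤ) (μ : ℤ) :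
    ((fProd a β γ).left (Multiplicative.ofAdd μ)).right =
      Multiplicative.ofAdd (∑ j ∈ Finset.univ.filter fun j => μ + γ j = 1, β j) := by
  rw [fProd_left_apply, ← rightHom_eq_right, map_list_prod, List.map_map]
  have h (j : Fin n) : (rightHom ∘ fun j =>
      (cElt a).left (Multiplicative.ofAdd (μ + γ j)) ^ β j) j =
        (Multiplicative.ofAdd (1 : ℤ)) ^ (if μ + γ j = 1 then β j else 0) := by
    rw [Function.comp_apply, map_zpow, rightHom_eq_right, cElt_left_right]
    split_ifs <;> simp
  rw [funext h, list_prod_map_zpow, ← Fin.sum_univ_def, ← ofAdd_zsmul, Finset.sum_filter]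
  simp

/-- If the exponent sums over equal `γ j` vanish and at most one of the points `μ + γ j` lies in
the support of `c`, then `f μ = 1`. -/
theorem fProd_left_eq_one (a : ℕ → H) {n : ℕ} (β γ : Fin n → ℤ) (μ : ℤ)
    (hsum : ∀ i : Fin n, (∑ j ∈ Finset.univ.filter fun j => γ j = γ i, β j) = 0)
    (huniq : ∀ i j : Fin n, (cElt a).left (Multiplicative.ofAdd (μ + γ i)) ≠ 1 →
      (cElt a).left (Multiplicative.ofAdd (μ + γ j)) ≠ 1 → γ j = γ i) :
    (fProd a β γ).left (Multiplicative.ofAdd μ) = 1 := by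
  rw [fProd_left_apply]
  by_cases hex : ∃ i, (cElt a).left (Multiplicative.ofAdd (μ + γ i)) ≠ 1
  · obtain ⟨i, hi⟩ := hex
    have h (j : Fin n) : (cElt a).left (Multiplicative.ofAdd (μ + γ j)) ^ β j =
        (cElt a).left (Multiplicative.ofAdd (μ + γ i)) ^ (if γ j = γ i then β j else 0) := by
      split_ifs with hji
      · rw [hji]
      · have hj : (cElt a).left (Multiplicative.ofAdd (μ + γ j)) = 1 := by
          by_contra hj
          exact hji (huniq i j hi hj)
        rw [hj, one_zpow, zpow_zero]
    rw [funext h, list_prod_map_zpow, ← Fin.sum_univ_def, ← Finset.sum_filter, hsum, zpow_zero]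
  · push Not at hex
    simp only [hex, one_zpow, List.map_const', List.prod_replicate, one_pow]

theorem two_pow_eq_of_lt_two_mul {x y : ℤ} (hx : ∃ i : ℕ, x = 2 ^ i) (hy : ∃ i : ℕ, y = 2 ^ i)
    (hxy : x < 2 * y) (hyx : y < 2 * x) : x = y := by
  obtain ⟨p, rfl⟩ := hx
  obtain ⟨q, rfl⟩ := hy
  rw [← pow_succ', pow_lt_pow_iff_right₀ one_lt_two] at hxy hyx
  congr 1
  omega

end Lemmas

/-- Lemma 3: `(c^(s^(γ 1)))^(β 1) ⋯ (c^(s^(γ n)))^(β n) * s^γ = 1` iff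
`γ = 0`, `∑_{j : γ j = γ i} β j = 0` for all `i`, and the passive part of `f` is trivial
at every `μ` with `|μ| ≤ 3 γ₀`. -/
theorem stmt9 {H : Type*} [Group H] (a : ℕ → H)
    (hgen : Subgroup.closure {x : H | ∃ i : ℕ, 1 ≤ i ∧ a i = x} = ⊤)
    (n : ℕ) (hn : 1 ≤ n) (β γ : Fin n → ℤ) (hβ : ∀ j, β j ≠ 0) (g : ℤ) :
    fProd a β γ * sElt ^ g = 1 ↔
      (g = 0 ∧
       (∀ i : Fin n, (∑ j ∈ Finset.univ.filter fun j => γ j = γ i, β j) = 0) ∧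
       ∀ μ : ℤ, |μ| ≤ 3 * (gamma0 γ : ℤ) →
         (fProd a β γ).left (Multiplicative.ofAdd μ) = 1) := by
  have hs : fProd a β γ * sElt ^ g = 1 ↔ g = 0 ∧ (fProd a β γ).left = 1 := by
    rw [fProd_eq_inl, sElt_zpow, SemidirectProduct.ext_iff]
    simp [and_comm]
  rw [hs]
  refine and_congr_right fun _ => ⟨fun hf => ⟨fun i => ?_, fun μ _ => congrFun hf _⟩, ?_⟩
  · have h := fProd_left_right a β γ (1 - γ i)
    rw [hf, Pi.one_apply, one_right, eq_comm, ofAdd_eq_one] at h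
    rw [← h]
    congr 1
    ext j
    simp only [Finset.mem_filter, Finset.mem_univ, true_and]
    omega
  · rintro ⟨hsum, hf⟩
    funext k
    obtain ⟨μ, rfl⟩ := Multiplicative.ofAdd.surjective k
    by_cases hμ : |μ| ≤ 3 * (gamma0 γ : ℤ)
    · exact hf μ hμ
    · rw [not_le, lt_abs] at hμ
      refine fProd_left_eq_one a β γ μ hsum fun i j hi hj => ?_
      have pow_of_ne {m : ℤ} (hm : (cElt a).left (Multiplicative.ofAdd m) ≠ 1) :
          ∃ p : ℕ, m = 2 ^ p := by
        by_contra! hp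
        exact hm (cElt_left_eq_one a hp)
      have bound (j : Fin n) : (γ j).natAbs ≤ gamma0 γ :=
        Finset.le_sup (f := fun j => (γ j).natAbs) (Finset.mem_univ j)
      have hi' := pow_of_ne hi
      have hj' := pow_of_ne hj
      have hpos : 0 < μ + γ i := by
        obtain ⟨p, hp⟩ := hi'
        rw [hp]
        positivity
      have hbi := bound i
      have hbj := bound j
      have h := two_pow_eq_of_lt_two_mul hi' hj' (by omega) (by omega)
      omega
end
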